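/- Let Φ be a norm on ℝ^{n+1} such that the boundary of B_Φ is a generalized graph in the vertical direction, let Ω̂ ⊆ ℝ^n be open, and let Ê ∈ BV_loc(Ω̂) be a minimizer of P_φ in Ω̂, where φ(ξ̂) = Φ(ξ̂,0) is the restriction of Φ to the horizontal hyperplane. Then the cylinder Ê × ℝ is a minimizer of P_Φ in Ω̂ × ℝ. -/

import Mathlib

open MeasureTheory Set Filter

noncomputable section

/-- `ℝ^n` with the Euclidean norm. -/
abbrev Rn (n : ℕ) := EuclideanSpace ℝ (Fin n)

/-- `ℝ^{n+1} = ℝ^n × ℝ`. -/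
abbrev Rn1 (n : ℕ) := Rn n × ℝ

/-- Euclidean dot product on `ℝ^n`. -/
def dotn {n : ℕ} (x y : Rn n) : ℝ := ∑ i, x i * y i

/-- Euclidean dot product on `ℝ^{n+1} = ℝ^n × ℝ`. -/
def dotp {n : ℕ} (x y : Rn1 n) : ℝ := dotn x.1 y.1 + x.2 * y.2

/-- Euclidean norm on `ℝ^{n+1} = ℝ^n × ℝ`. -/
def enorm1 {n : ℕ} (x : Rn1 n) : ℝ := Real.sqrt (dotp x x)

/-- `Ψ` is a norm on `ℝ^n`: convex, absolutely one-homogeneous and bounded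
below by a positive multiple of the Euclidean norm. -/
def IsNormN {n : ℕ} (Ψ : Rn n → ℝ) : Prop :=
  ConvexOn ℝ univ Ψ ∧ (∀ (c : ℝ) (ξ : Rn n), Ψ (c • ξ) = |c| * Ψ ξ) ∧
    ∃ c > (0:ℝ), ∀ ξ, c * ‖ξ‖ ≤ Ψ ξ

/-- `Φ` is a norm on `ℝ^{n+1}`. -/
def IsNorm1 {n : ℕ} (Φ : Rn1 n → ℝ) : Prop :=
  ConvexOn ℝ univ Φ ∧ (∀ (c : ℝ) (ξ : Rn1 n), Φ (c • ξ) = |c| * Φ ξ) ∧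
    ∃ c > (0:ℝ), ∀ ξ, c * enorm1 ξ ≤ Φ ξ

/-- Dual norm on `ℝ^n`: `Ψ^o(ξ*) = sup {ξ*·ξ : Ψ(ξ) ≤ 1}`. -/
def dualN {n : ℕ} (Ψ : Rn n → ℝ) (xs : Rn n) : ℝ :=
  sSup ((fun ξ => dotn xs ξ) '' {ξ | Ψ ξ ≤ 1})

/-- Dual norm on `ℝ^{n+1}`. -/
def dual1 {n : ℕ} (Φ : Rn1 n → ℝ) (xs : Rn1 n) : ℝ :=
  sSup ((fun ξ => dotp xs ξ) '' {ξ | Φ ξ ≤ 1})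

/-- `Φ` is cylindrical over `φ`: `Φ(ξ̂,ξ_{n+1}) = max (φ(ξ̂), |ξ_{n+1}|)`. -/
def Cylindrical {n : ℕ} (Φ : Rn1 n → ℝ) (φ : Rn n → ℝ) : Prop :=
  ∀ ξ : Rn1 n, Φ ξ = max (φ ξ.1) |ξ.2|

/-- `A` is an open set compactly contained in `O`. -/
def CpCtd {E : Type*} [TopologicalSpace E] (A O : Set E) : Prop :=
  IsOpen A ∧ IsCompact (closure A) ∧ closure A ⊆ O

/-- Divergence of a vector field on `ℝ^n`. -/
def divN {n : ℕ} (η : Rn n → Rn n) (x : Rn n) : ℝ :=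
  ∑ i, fderiv ℝ η x (EuclideanSpace.single i (1:ℝ)) i

/-- Divergence of a vector field on `ℝ^{n+1} = ℝ^n × ℝ`. -/
def div1 {n : ℕ} (η : Rn1 n → Rn1 n) (z : Rn1 n) : ℝ :=
  (∑ i, (fderiv ℝ η z (EuclideanSpace.single i (1:ℝ), (0:ℝ))).1 i) +
    (fderiv ℝ η z ((0 : Rn n), (1:ℝ))).2

/-- Admissible test vector fields on `ℝ^n`: `C^1`, compactly supported in `A`,
with values in the unit ball of `Ψ`. -/
def TestN {n : ℕ} (A : Set (Rn n)) (Ψ : Rn n → ℝ) (η : Rn n → Rn n) : Prop :=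
  ContDiff ℝ 1 η ∧ HasCompactSupport η ∧ tsupport η ⊆ A ∧ ∀ x, Ψ (η x) ≤ 1

/-- Admissible test vector fields on `ℝ^{n+1}`. -/
def Test1 {n : ℕ} (A : Set (Rn1 n)) (Φ : Rn1 n → ℝ) (η : Rn1 n → Rn1 n) : Prop :=
  ContDiff ℝ 1 η ∧ HasCompactSupport η ∧ tsupport η ⊆ A ∧ ∀ z, Φ (η z) ≤ 1

/-- The set of numbers whose supremum is the anisotropic perimeter `P_Ψ(E,A)` in `ℝ^n`. -/
def perSetN {n : ℕ} (Ψ : Rn n → ℝ) (E A : Set (Rn n)) : Set ℝ :=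
  {r | ∃ η, TestN A Ψ η ∧ r = -∫ x in E, divN η x}

/-- Anisotropic perimeter `P_Ψ(E,A)` in `ℝ^n`. -/
def PerN {n : ℕ} (Ψ : Rn n → ℝ) (E A : Set (Rn n)) : ℝ := sSup (perSetN Ψ E A)

/-- `E` has locally finite perimeter in `O ⊆ ℝ^n`. -/
def BVlocSetN {n : ℕ} (O E : Set (Rn n)) : Prop :=
  ∀ A, CpCtd A O → BddAbove (perSetN (fun x => ‖x‖) E A)

/-- `E` is a minimizer of `P_Ψ` (by compact perturbations) in `O ⊆ ℝ^n`. -/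
def MinPerN {n : ℕ} (Ψ : Rn n → ℝ) (O E : Set (Rn n)) : Prop :=
  BVlocSetN O E ∧ ∀ A, CpCtd A O → ∀ F, BVlocSetN O F →
    IsCompact (closure (symmDiff E F)) → closure (symmDiff E F) ⊆ A →
      PerN Ψ E A ≤ PerN Ψ F A

/-- The set of numbers whose supremum is the anisotropic perimeter `P_Φ(E,A)` in `ℝ^{n+1}`. -/
def perSet1 {n : ℕ} (Φ : Rn1 n → ℝ) (E A : Set (Rn1 n)) : Set ℝ :=
  {r | ∃ η, Test1 A Φ η ∧ r = -∫ z in E, div1 η z}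

/-- Anisotropic perimeter `P_Φ(E,A)` in `ℝ^{n+1}`. -/
def Per1 {n : ℕ} (Φ : Rn1 n → ℝ) (E A : Set (Rn1 n)) : ℝ := sSup (perSet1 Φ E A)

/-- `E` has locally finite perimeter in `O ⊆ ℝ^{n+1}`. -/
def BVlocSet1 {n : ℕ} (O E : Set (Rn1 n)) : Prop :=
  ∀ A, CpCtd A O → BddAbove (perSet1 enorm1 E A)

/-- `E` is a minimizer of `P_Φ` (by compact perturbations) in `O ⊆ ℝ^{n+1}`. -/
def MinPer1 {n : ℕ} (Φ : Rn1 n → ℝ) (O E : Set (Rn1 n)) : Prop :=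
  BVlocSet1 O E ∧ ∀ A, CpCtd A O → ∀ F, BVlocSet1 O F →
    IsCompact (closure (symmDiff E F)) → closure (symmDiff E F) ⊆ A →
      Per1 Φ E A ≤ Per1 Φ F A

/-- The set of numbers whose supremum is the total variation `TV(u,A)`. -/
def varSet {n : ℕ} (A : Set (Rn n)) (u : Rn n → ℝ) : Set ℝ :=
  {r | ∃ η, TestN A (fun x => ‖x‖) η ∧ r = ∫ x in A, u x * divN η x}

/-- Total variation `TV(u,A)`. -/
def TV {n : ℕ} (u : Rn n → ℝ) (A : Set (Rn n)) : ℝ := sSup (varSet A u)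

/-- `u ∈ BV_loc(Ω̂)`. -/
def BVlocFun {n : ℕ} (Ω : Set (Rn n)) (u : Rn n → ℝ) : Prop :=
  (∀ A, CpCtd A Ω → IntegrableOn u A) ∧ ∀ A, CpCtd A Ω → BddAbove (varSet A u)

/-- The set of numbers whose supremum is `G_{Φ^o}(u,A)`. -/
def Gset {n : ℕ} (Φ : Rn1 n → ℝ) (A : Set (Rn n)) (u : Rn n → ℝ) : Set ℝ :=
  {r | ∃ η : Rn n → Rn1 n, ContDiff ℝ 1 η ∧ HasCompactSupport η ∧ tsupport η ⊆ A ∧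
    (∀ x, Φ (η x) ≤ 1) ∧ r = ∫ x in A, (u x * divN (fun y => (η y).1) x + (η x).2)}

/-- The functional `G_{Φ^o}(u,A)`. -/
def Gfun {n : ℕ} (Φ : Rn1 n → ℝ) (u : Rn n → ℝ) (A : Set (Rn n)) : ℝ := sSup (Gset Φ A u)

/-- `w` has compact support contained in `A`. -/
def CptSupp {n : ℕ} (A : Set (Rn n)) (w : Rn n → ℝ) : Prop :=
  IsCompact (tsupport w) ∧ tsupport w ⊆ A

/-- `u` is a minimizer of `G_{Φ^o}` by compact perturbations in `Ω̂`,
i.e. `u ∈ M_{Φ^o}(Ω̂)`. -/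
def MinG {n : ℕ} (Φ : Rn1 n → ℝ) (Ω : Set (Rn n)) (u : Rn n → ℝ) : Prop :=
  BVlocFun Ω u ∧ ∀ A, CpCtd A Ω → ∀ v, BVlocFun Ω v →
    CptSupp A (fun x => u x - v x) → Gfun Φ u A ≤ Gfun Φ v A

/-- `u` is a minimizer of the total variation by compact perturbations in `Ω̂`. -/
def MinTV {n : ℕ} (Ω : Set (Rn n)) (u : Rn n → ℝ) : Prop :=
  BVlocFun Ω u ∧ ∀ A, CpCtd A Ω → ∀ v, BVlocFun Ω v →
    CptSupp A (fun x => u x - v x) → TV u A ≤ TV v A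

/-- Subgraph of `u : Ω̂ → ℝ`. -/
def sg {n : ℕ} (Ω : Set (Rn n)) (u : Rn n → ℝ) : Set (Rn1 n) :=
  {p | p.1 ∈ Ω ∧ p.2 < u p.1}

/-- `S` is locally a Lipschitz graph at `p`. -/
def IsLocLipGraphAt {n : ℕ} (S : Set (Rn1 n)) (p : Rn1 n) : Prop :=
  ∃ U : Set (Rn1 n), IsOpen U ∧ p ∈ U ∧ ∃ e : Rn1 n, enorm1 e = 1 ∧
    ∃ g : Rn1 n → ℝ, (∃ L : NNReal, LipschitzOnWith L g {y | dotp y e = 0}) ∧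
      S ∩ U = {z | ∃ y, dotp y e = 0 ∧ z = y + g y • e} ∩ U

/-- `Φ` is a partially monotone norm on `ℝ^{n+1}`. -/
def PartMono {n : ℕ} (Φ : Rn1 n → ℝ) : Prop :=
  ∀ ξ η : Rn1 n, Φ (ξ.1, 0) ≤ Φ (η.1, 0) → Φ ((0 : Rn n), ξ.2) ≤ Φ ((0 : Rn n), η.2) →
    Φ ξ ≤ Φ η

end

open scoped ContDiff Manifold Topology

lemma cutoff_exists {V : Type*} [NormedAddCommGroup V] [NormedSpace ℝ V] [FiniteDimensional ℝ V]
    {K U : Set V} (hK : IsCompact K) (hU : IsOpen U) (hKU : K ⊆ U) :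
    ∃ χ : V → ℝ, ContDiff ℝ 1 χ ∧ HasCompactSupport χ ∧ tsupport χ ⊆ U ∧
      (∀ x ∈ K, ∀ᶠ y in 𝓝 x, χ y = 1) ∧ ∀ x, χ x ∈ Icc (0:ℝ) 1 := by
  obtain ⟨L, hL, hKL, hLU⟩ := exists_compact_between hK hU hKU
  obtain ⟨f, hf1, hf0, hf⟩ := exists_contMDiffMap_one_nhds_of_subset_interior (n := ⊤) 𝓘(ℝ, V)
    hK.isClosed hKL
  have hs : tsupport f ⊆ L := by
    apply closure_minimal _ hL.isClosed
    intro x hx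
    by_contra h
    exact hx (hf0 x h)
  refine ⟨f, ?_, HasCompactSupport.of_support_subset_isCompact hL (subset_closure.trans hs),
    hs.trans hLU, eventually_nhdsSet_iff_forall.1 hf1, hf⟩
  exact f.contMDiff.contDiff.of_le (by exact_mod_cast le_top)

lemma divN_continuous {n : ℕ} {η : Rn n → Rn n} (h : ContDiff ℝ 1 η) : Continuous (divN η) := by
  unfold divN
  have := h.continuous_fderiv (by norm_num)
  fun_prop

lemma divN_hasCompactSupport {n : ℕ} {η : Rn n → Rn n} (h : HasCompactSupport η) :
    HasCompactSupport (divN η) := by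
  have := h.fderiv (𝕜 := ℝ)
  apply this.mono
  intro x hx hx'
  apply hx
  simp [divN, hx']

lemma divN_integrable {n : ℕ} {η : Rn n → Rn n} (h : ContDiff ℝ 1 η) (h' : HasCompactSupport η) :
    Integrable (divN η) :=
  (divN_continuous h).integrable_of_hasCompactSupport (divN_hasCompactSupport h')

lemma div1_continuous {n : ℕ} {η : Rn1 n → Rn1 n} (h : ContDiff ℝ 1 η) : Continuous (div1 η) := by
  unfold div1
  have := h.continuous_fderiv (by norm_num)
  fun_prop

lemma div1_hasCompactSupport {n : ℕ} {η : Rn1 n → Rn1 n} (h : HasCompactSupport η) :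
    HasCompactSupport (div1 η) := by
  have := h.fderiv (𝕜 := ℝ)
  apply this.mono
  intro x hx hx'
  apply hx
  simp [div1, hx']

lemma div1_integrable {n : ℕ} {η : Rn1 n → Rn1 n} (h : ContDiff ℝ 1 η)
    (h' : HasCompactSupport η) : Integrable (div1 η) :=
  (div1_continuous h).integrable_of_hasCompactSupport (div1_hasCompactSupport h')

lemma divN_add {n : ℕ} {η θ : Rn n → Rn n} (h : ContDiff ℝ 1 η) (h' : ContDiff ℝ 1 θ)
    (x : Rn n) : divN (fun y => η y + θ y) x = divN η x + divN θ x := by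
  unfold divN
  rw [fderiv_fun_add (h.differentiable (by norm_num) x) (h'.differentiable (by norm_num) x),
    ← Finset.sum_add_distrib]
  simp

lemma divN_smul {n : ℕ} {η : Rn n → Rn n} (h : ContDiff ℝ 1 η) (c : ℝ)
    (x : Rn n) : divN (fun y => c • η y) x = c * divN η x := by
  unfold divN
  rw [fderiv_fun_const_smul (h.differentiable (by norm_num) x), Finset.mul_sum]
  simp

lemma div1_smul {n : ℕ} {η : Rn1 n → Rn1 n} (h : ContDiff ℝ 1 η) (c : ℝ)
    (x : Rn1 n) : div1 (fun y => c • η y) x = c * div1 η x := by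
  unfold div1
  rw [fderiv_fun_const_smul (h.differentiable (by norm_num) x), mul_add, Finset.mul_sum]
  simp

lemma cs_smul {X V : Type*} [TopologicalSpace X] [NormedAddCommGroup V] [NormedSpace ℝ V]
    {η : X → V} (a : X → ℝ) (h : HasCompactSupport η) :
    HasCompactSupport (fun x => a x • η x) := by
  apply h.mono
  intro x hx hx'
  apply hx
  simp [hx']

lemma ts_smul {X V : Type*} [TopologicalSpace X] [NormedAddCommGroup V] [NormedSpace ℝ V]
    {η : X → V} (a : X → ℝ) : tsupport (fun x => a x • η x) ⊆ tsupport η := by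
  apply closure_mono
  intro x hx hx'
  apply hx
  simp [hx']

lemma ts_smul' {X V : Type*} [TopologicalSpace X] [NormedAddCommGroup V] [NormedSpace ℝ V]
    {η : X → V} (a : X → ℝ) : tsupport (fun x => a x • η x) ⊆ tsupport a := by
  apply closure_mono
  intro x hx hx'
  apply hx
  simp [hx']

lemma enorm1_hor {n : ℕ} (x : Rn n) : enorm1 (x, (0:ℝ)) = ‖x‖ := by
  simp [enorm1, dotp, dotn, EuclideanSpace.norm_eq, pow_two]

lemma enorm1_fst_le {n : ℕ} (x : Rn1 n) : ‖x.1‖ ≤ enorm1 x := by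
  rw [← enorm1_hor]
  unfold enorm1 dotp
  apply Real.sqrt_le_sqrt
  simp only [mul_zero, add_zero]
  nlinarith [mul_self_nonneg x.2]

lemma enorm1_smul {n : ℕ} (c : ℝ) (x : Rn1 n) : enorm1 (c • x) = |c| * enorm1 x := by
  unfold enorm1
  rw [← Real.sqrt_sq_eq_abs, ← Real.sqrt_mul (sq_nonneg c)]
  congr 1
  simp only [dotp, dotn, Prod.smul_fst, Prod.smul_snd, PiLp.smul_apply, smul_eq_mul, mul_add,
    Finset.mul_sum]
  congr 1
  · exact Finset.sum_congr rfl fun i _ => by ring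
  · ring

lemma norm_upper {n : ℕ} {Φ : Rn1 n → ℝ} (hΦ : IsNorm1 Φ) :
    ∃ C > (0:ℝ), ∀ x : Rn n, Φ (x, (0:ℝ)) ≤ C * ‖x‖ := by
  obtain ⟨hc, hh, -⟩ := hΦ
  have hcont : Continuous Φ := by
    rw [← continuousOn_univ]
    exact hc.continuousOn isOpen_univ
  have hcont' : Continuous (fun x : Rn n => Φ (x, (0:ℝ))) := by fun_prop
  obtain ⟨C, hC⟩ := (isCompact_closedBall (0 : Rn n) 1).bddAbove_image hcont'.continuousOn
  refine ⟨max C 1, by positivity, fun x => ?_⟩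
  by_cases hx : x = 0
  · subst hx
    have := hh 0 (0, 0)
    rw [zero_smul, abs_zero, zero_mul] at this
    rw [norm_zero, mul_zero]
    exact this.le
  have hx' : ‖x‖ ≠ 0 := by simpa using hx
  have h1 : Φ (x, (0:ℝ)) = ‖x‖ * Φ (‖x‖⁻¹ • x, (0:ℝ)) := by
    have := hh ‖x‖ (‖x‖⁻¹ • x, (0:ℝ))
    simp only [Prod.smul_mk, smul_smul, mul_inv_cancel₀ hx', one_smul, smul_zero, abs_norm] at this
    exact this
  rw [h1, mul_comm]
  gcongr
  refine (hC ⟨‖x‖⁻¹ • x, ?_, rfl⟩).trans (le_max_left _ _)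
  simp [norm_smul, inv_mul_cancel₀ hx']

/-- bounded anisotropic perimeter from BV -/
lemma bddN {n : ℕ} {Φ : Rn1 n → ℝ} (hΦ : IsNorm1 Φ) {E A : Set (Rn n)}
    (h : BddAbove (perSetN (fun x => ‖x‖) E A)) :
    BddAbove (perSetN (fun x => Φ (x, (0:ℝ))) E A) := by
  obtain ⟨-, -, c, hc, hb⟩ := hΦ
  obtain ⟨M, hM⟩ := h
  refine ⟨c⁻¹ * M, ?_⟩
  rintro r ⟨η, ⟨h1, h2, h3, h4⟩, rfl⟩
  have := hM ⟨fun x => c • η x, ⟨h1.const_smul c, cs_smul (fun _ => c) h2,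
    (ts_smul (fun _ => c)).trans h3, fun x => ?_⟩, rfl⟩
  · simp_rw [divN_smul h1, integral_const_mul] at this
    rw [← mul_neg] at this
    rw [inv_mul_eq_div, le_div_iff₀ hc, mul_comm]
    exact this
  · have := hb (η x, 0)
    rw [enorm1_hor] at this
    simp only [norm_smul, Real.norm_eq_abs, abs_of_pos hc]
    exact this.trans (h4 x)

lemma bdd1 {n : ℕ} {Φ : Rn1 n → ℝ} (hΦ : IsNorm1 Φ) {E A : Set (Rn1 n)}
    (h : BddAbove (perSet1 enorm1 E A)) :
    BddAbove (perSet1 Φ E A) := by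
  obtain ⟨-, -, c, hc, hb⟩ := hΦ
  obtain ⟨M, hM⟩ := h
  refine ⟨c⁻¹ * M, ?_⟩
  rintro r ⟨η, ⟨h1, h2, h3, h4⟩, rfl⟩
  have := hM ⟨fun x => c • η x, ⟨h1.const_smul c, cs_smul (fun _ => c) h2,
    (ts_smul (fun _ => c)).trans h3, fun x => ?_⟩, rfl⟩
  · simp_rw [div1_smul h1, integral_const_mul] at this
    rw [← mul_neg] at this
    rw [inv_mul_eq_div, le_div_iff₀ hc, mul_comm]
    exact this
  · simp only [enorm1_smul, abs_of_pos hc]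
    exact (hb _).trans (h4 x)

lemma integral_agree {X : Type*} [MeasurableSpace X] {μ : Measure X} {E G K : Set X} {g : X → ℝ}
    (hg : Integrable g μ) (hK : MeasurableSet K) (h : symmDiff E G ⊆ K) (h0 : ∀ x ∈ K, g x = 0) :
    ∫ x in G, g x ∂μ = ∫ x in E, g x ∂μ := by
  rw [← integral_inter_add_sdiff hK hg.integrableOn (s := G),
    ← integral_inter_add_sdiff hK hg.integrableOn (s := E),
    setIntegral_eq_zero_of_forall_eq_zero (t := G ∩ K) (fun x hx => h0 x hx.2),
    setIntegral_eq_zero_of_forall_eq_zero (t := E ∩ K) (fun x hx => h0 x hx.2)]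
  have : G \ K = E \ K := by
    ext x
    have := @h x
    simp only [Set.mem_symmDiff, Set.mem_sdiff] at *
    tauto
  rw [this]

/-- the slice competitor lemma -/
lemma slice_key {n : ℕ} {Φ : Rn1 n → ℝ} (hΦ : IsNorm1 Φ) {Ω E : Set (Rn n)}
    (hmin : MinPerN (fun ξh : Rn n => Φ (ξh, (0:ℝ))) Ω E) {P K G : Set (Rn n)}
    (hP : CpCtd P Ω) (hK : IsCompact K) (hKP : K ⊆ P) (hG : symmDiff E G ⊆ K)
    {θ : Rn n → Rn n} (hθ : TestN P (fun ξh : Rn n => Φ (ξh, (0:ℝ))) θ) {ε : ℝ} (hε : 0 < ε) :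
    ∃ ζ, TestN P (fun ξh : Rn n => Φ (ξh, (0:ℝ))) ζ ∧
      (-∫ x in E, divN θ x) - ε < -∫ x in G, divN ζ x := by
  by_cases hb : BddAbove (perSetN (fun ξh : Rn n => Φ (ξh, (0:ℝ))) G P)
  swap
  · rw [not_bddAbove_iff] at hb
    obtain ⟨r, ⟨ζ, hζ, rfl⟩, hr⟩ := hb ((-∫ x in E, divN θ x) - ε)
    exact ⟨ζ, hζ, hr⟩
  have hGBV : BVlocSetN Ω G := by
    intro A hA
    obtain ⟨χ, hχ1, hχ2, hχ3, hχ4, hχ5⟩ := cutoff_exists hK hP.1 hKP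
    obtain ⟨C, hC, hCu⟩ := norm_upper hΦ
    obtain ⟨M, hM⟩ := hb
    obtain ⟨M', hM'⟩ := hmin.1 A hA
    refine ⟨C * M + M', ?_⟩
    rintro r ⟨η, ⟨h1, h2, h3, h4⟩, rfl⟩
    have c1 : ContDiff ℝ 1 (fun x => χ x • η x) := hχ1.smul h1
    have c2 : ContDiff ℝ 1 (fun x => (1 - χ x) • η x) := (contDiff_const.sub hχ1).smul h1
    have s1 : HasCompactSupport (fun x => χ x • η x) := cs_smul _ h2
    have s2 : HasCompactSupport (fun x => (1 - χ x) • η x) := cs_smul _ h2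
    have hdiv : ∀ x, divN η x = divN (fun x => χ x • η x) x +
        divN (fun x => (1 - χ x) • η x) x := by
      intro x
      rw [← divN_add c1 c2]
      congr 1
      ext1 y
      rw [← add_smul]; simp
    simp_rw [hdiv]
    rw [integral_add (divN_integrable c1 s1).integrableOn (divN_integrable c2 s2).integrableOn,
      neg_add]
    refine add_le_add ?_ ?_
    · have := hM ⟨fun x => C⁻¹ • (χ x • η x), ⟨c1.const_smul C⁻¹, cs_smul (fun _ => C⁻¹) s1,
        ((ts_smul (fun _ => C⁻¹)).trans (ts_smul' _)).trans hχ3, fun x => ?_⟩, rfl⟩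
      · simp_rw [divN_smul c1, integral_const_mul] at this
        rw [← mul_neg, inv_mul_le_iff₀ hC] at this
        exact this
      · refine (hCu _).trans ?_
        rw [norm_smul, norm_smul, Real.norm_eq_abs, Real.norm_eq_abs, abs_of_pos (inv_pos.2 hC),
          mul_inv_cancel_left₀ hC.ne', abs_of_nonneg (hχ5 x).1]
        exact mul_le_one₀ (hχ5 x).2 (norm_nonneg _) (h4 x)
    · rw [integral_agree (divN_integrable c2 s2) hK.measurableSet hG]
      · refine hM' ⟨_, ⟨c2, s2, (ts_smul _).trans h3, fun x => ?_⟩, rfl⟩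
        · beta_reduce
          rw [norm_smul, Real.norm_eq_abs, abs_of_nonneg (by linarith [(hχ5 x).2])]
          exact mul_le_one₀ (by linarith [(hχ5 x).1]) (norm_nonneg _) (h4 x)
      · intro x hx
        have : (fun x => (1 - χ x) • η x) =ᶠ[𝓝 x] fun _ => 0 := by
          filter_upwards [hχ4 x hx] with y hy
          simp [hy]
        simp [divN, this.fderiv_eq]
  have hcl : closure (symmDiff E G) ⊆ K := closure_minimal hG hK.isClosed
  have hmain := hmin.2 P hP G hGBV (hK.of_isClosed_subset isClosed_closure hcl) (hcl.trans hKP)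
  have h1 : (-∫ x in E, divN θ x) ≤ PerN (fun ξh : Rn n => Φ (ξh, (0:ℝ))) E P :=
    le_csSup (bddN hΦ (hmin.1 P hP)) ⟨θ, hθ, rfl⟩
  have hne : (perSetN (fun ξh : Rn n => Φ (ξh, (0:ℝ))) G P).Nonempty := ⟨_, θ, hθ, rfl⟩
  obtain ⟨r, ⟨ζ, hζ, rfl⟩, hr⟩ := exists_lt_of_lt_csSup hne
    (show (-∫ x in E, divN θ x) - ε < sSup _ by unfold PerN at hmain h1; linarith)
  exact ⟨ζ, hζ, hr⟩

lemma countable_tests {n : ℕ} (φ : Rn n → ℝ) (h0 : φ 0 ≤ 1) :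
    ∃ ζ : ℕ → Rn n → Rn n, (∀ j, TestN univ φ (ζ j)) ∧
      ∀ U : Set (Rn n), IsOpen U → ∀ θ, TestN U φ θ → ∀ ε > (0:ℝ),
        ∃ j, tsupport (ζ j) ⊆ U ∧ ∫ x, |divN (ζ j) x - divN θ x| < ε := by
  classical
  have key : ∀ V : Set (Rn n), ∃ D : Set (Rn n → Rn n), D.Countable ∧ (∀ ζ ∈ D, TestN V φ ζ) ∧
      ∀ θ, TestN V φ θ → ∀ ε > (0:ℝ), ∃ ζ ∈ D, ∫ x, |divN ζ x - divN θ x| < ε := by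
    intro V
    let q : {ζ : Rn n → Rn n // TestN V φ ζ} → (Rn n →₁[volume] ℝ) := fun ζ =>
      (divN_integrable ζ.2.1 ζ.2.2.1).toL1 _
    have : Fact ((1 : ENNReal) ≠ ⊤) := ⟨ENNReal.one_ne_top⟩
    obtain ⟨D, hD1, hD2, hD3⟩ :=
      (TopologicalSpace.IsSeparable.of_separableSpace (range q)).exists_countable_dense_subset
    have : Nonempty {ζ : Rn n → Rn n // TestN V φ ζ} :=
      ⟨⟨fun _ => 0, contDiff_const, HasCompactSupport.zero,
        by simp [tsupport, Function.support_fun_zero], fun _ => h0⟩⟩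
    have hD1' : ∀ d, d ∈ D → ∃ z, q z = d := fun d hd => hD1 hd
    choose! p hp using hD1'
    refine ⟨(fun d => (p d).1) '' D, hD2.image _, ?_, ?_⟩
    · rintro _ ⟨d, -, rfl⟩
      exact (p d).2
    · intro θ hθ ε hε
      have := hD3 ⟨⟨θ, hθ⟩, rfl⟩
      obtain ⟨d, hd, hdist⟩ := Metric.mem_closure_iff.1 this ε hε
      refine ⟨_, ⟨d, hd, rfl⟩, ?_⟩
      rw [dist_comm, dist_eq_norm, ← hp d hd] at hdist
      simp only [q] at hdist
      rw [← Integrable.toL1_sub, L1.norm_of_fun_eq_integral_norm] at hdist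
      simpa using hdist
  choose D hD1 hD2 hD3 using key
  let B := TopologicalSpace.countableBasis (Rn n)
  have hB : B.Countable := TopologicalSpace.countable_countableBasis _
  have hBb : TopologicalSpace.IsTopologicalBasis B := TopologicalSpace.isBasis_countableBasis _
  let 𝒱 : Set (Set (Rn n)) := sUnion '' {s | s.Finite ∧ s ⊆ B}
  have h𝒱 : 𝒱.Countable := (Set.countable_ofPred_finite_subset hB).image _
  let T := ⋃ V ∈ 𝒱, D V
  have hT : T.Countable := h𝒱.biUnion fun V _ => hD1 V
  have hfind : ∀ U : Set (Rn n), IsOpen U → ∀ θ, TestN U φ θ → ∀ ε > (0:ℝ),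
        ∃ ζ ∈ T, tsupport ζ ⊆ U ∧ ∫ x, |divN ζ x - divN θ x| < ε := by
    intro U hU θ hθ ε hε
    have hcov : ∃ V ∈ 𝒱, tsupport θ ⊆ V ∧ V ⊆ U := by
      have hc : IsCompact (tsupport θ) := hθ.2.1
      obtain ⟨s, hs1, hs2, hs3⟩ := hc.elim_finite_subcover_image
        (b := {v | v ∈ B ∧ v ⊆ U}) (c := fun v => v) (fun v hv => hBb.isOpen hv.1) (by
          intro x hx
          obtain ⟨v, hv, hxv, hvU⟩ := hBb.exists_subset_of_mem_open (hθ.2.2.1 hx) hU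
          exact mem_biUnion (show v ∈ {v | v ∈ B ∧ v ⊆ U} from ⟨hv, hvU⟩) hxv)
      refine ⟨⋃₀ s, ⟨s, ⟨hs2, fun v hv => (hs1 hv).1⟩, rfl⟩, ?_, ?_⟩
      · rw [sUnion_eq_biUnion]; exact hs3
      · exact sUnion_subset fun v hv => (hs1 hv).2
    obtain ⟨V, hV, h1, h2⟩ := hcov
    obtain ⟨ζ, hζ, hlt⟩ := hD3 V θ ⟨hθ.1, hθ.2.1, h1, hθ.2.2.2⟩ ε hε
    exact ⟨ζ, mem_biUnion hV hζ, (hD2 V ζ hζ).2.2.1.trans h2, hlt⟩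
  have hne : T.Nonempty := by
    obtain ⟨ζ, hζ, -⟩ := hfind univ isOpen_univ (fun _ => 0) ⟨contDiff_const,
      HasCompactSupport.zero, subset_univ _, fun _ => h0⟩ 1 one_pos
    exact ⟨ζ, hζ⟩
  obtain ⟨ζ, hζ⟩ := hT.exists_eq_range hne
  refine ⟨ζ, fun j => ?_, fun U hU θ hθ ε hε => ?_⟩
  · have : ζ j ∈ T := hζ ▸ mem_range_self j
    obtain ⟨V, hV, hj⟩ := mem_iUnion₂.1 this
    obtain ⟨a, b, c, d⟩ := hD2 V _ hj
    exact ⟨a, b, subset_univ _, d⟩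
  · obtain ⟨z, hz, h1, h2⟩ := hfind U hU θ hθ ε hε
    rw [hζ] at hz
    obtain ⟨j, rfl⟩ := hz
    exact ⟨j, h1, h2⟩

lemma slices_exist {n : ℕ} (E : Set (Rn n)) (F K : Set (Rn1 n)) (hK : IsClosed K)
    (h : symmDiff (E ×ˢ (univ : Set ℝ)) F ⊆ K) :
    ∃ G : ℝ → Set (Rn n), (∀ t, symmDiff E (G t) ⊆ {x | (x, t) ∈ K}) ∧
      (∀ f : Rn1 n → ℝ, Continuous f → (∀ t, Integrable fun x => f (x, t)) →
        StronglyMeasurable fun t => ∫ x in G t, f (x, t)) ∧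
      (∀ f : Rn1 n → ℝ, Continuous f → HasCompactSupport f →
        ∫ z in F, f z = ∫ t, ∫ x in G t, f (x, t)) := by
  classical
  have hKm : MeasurableSet K := hK.measurableSet
  let F1 : Set (Rn1 n) := toMeasurable volume (F ∩ K) ∩ K
  have hF1 : MeasurableSet F1 := (measurableSet_toMeasurable _ _).inter hKm
  have hF1r : (volume : Measure (Rn1 n)).restrict F1 = volume.restrict (F ∩ K) := by
    have h1 := Measure.restrict_toMeasurable_of_sFinite (μ := (volume : Measure (Rn1 n))) (F ∩ K)
    have : F1 = K ∩ toMeasurable volume (F ∩ K) := inter_comm _ _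
    rw [this, ← Measure.restrict_restrict hKm, h1, Measure.restrict_restrict hKm]
    congr 1
    ext x; simp
  have hsl1 : ∀ t : ℝ, MeasurableSet {x : Rn n | (x, t) ∈ F1} := fun t =>
    (measurable_prodMk_right (y := t)) hF1
  have hslK : ∀ t : ℝ, MeasurableSet {x : Rn n | (x, t) ∈ Kᶜ} := fun t =>
    (measurable_prodMk_right (y := t)) hKm.compl
  let G : ℝ → Set (Rn n) := fun t => (E ∩ {x | (x, t) ∈ Kᶜ}) ∪ {x | (x, t) ∈ F1}
  have hGint : ∀ f : Rn1 n → ℝ, (∀ t, Integrable fun x => f (x, t)) → ∀ t,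
      ∫ x in G t, f (x, t) = (∫ x in E, Kᶜ.indicator f (x, t)) + ∫ x, F1.indicator f (x, t) := by
    intro f hf t
    rw [setIntegral_union _ (hsl1 t) (hf t).integrableOn (hf t).integrableOn]
    · congr 1
      · rw [← setIntegral_indicator (hslK t)]
        rfl
      · rw [← integral_indicator (hsl1 t)]
        rfl
    · rw [Set.disjoint_left]
      intro x hx hx'
      exact hx.2 hx'.2
  refine ⟨G, ?_, ?_, ?_⟩
  · intro t x hx
    by_contra hxK
    have hxK : (x, t) ∉ K := hxK
    simp only [G, Set.mem_symmDiff, mem_union, mem_inter_iff, mem_ofPred_eq, F1, mem_compl_iff] at hx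
    tauto
  · intro f hf hfi
    simp_rw [hGint f hfi]
    have hm := hf.stronglyMeasurable
    exact ((hm.indicator hKm.compl).integral_prod_left' (μ := volume.restrict E)).add
      ((hm.indicator hF1).integral_prod_left' (μ := volume))
  · intro f hf hfc
    have hfi : Integrable f := hf.integrable_of_hasCompactSupport hfc
    have hsl : ∀ t : ℝ, Integrable fun x : Rn n => f (x, t) := by
      intro t
      apply Continuous.integrable_of_hasCompactSupport (by fun_prop)
      have : IsCompact (Prod.fst '' tsupport f) := IsCompact.image hfc continuous_fst
      apply HasCompactSupport.intro this
      intro x hx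
      by_contra h
      exact hx ⟨(x, t), subset_tsupport _ h, rfl⟩
    simp_rw [hGint f hsl]
    have hA : Integrable (Kᶜ.indicator f)
        (((volume : Measure (Rn n)).restrict E).prod (volume : Measure ℝ)) := by
      have : ((volume : Measure (Rn n)).restrict E).prod (volume : Measure ℝ) =
          (volume : Measure (Rn1 n)).restrict (E ×ˢ univ) := by
        rw [Measure.volume_eq_prod, ← Measure.prod_restrict, Measure.restrict_univ]
      rw [this]
      exact (hfi.indicator hKm.compl).restrict
    have hB : Integrable (F1.indicator f)
        ((volume : Measure (Rn n)).prod (volume : Measure ℝ)) := hfi.indicator hF1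
    have hAr : ((volume : Measure (Rn n)).restrict E).prod (volume : Measure ℝ) =
          (volume : Measure (Rn1 n)).restrict (E ×ˢ univ) := by
        rw [Measure.volume_eq_prod, ← Measure.prod_restrict, Measure.restrict_univ]
    rw [integral_add hA.integral_prod_right hB.integral_prod_right,
      ← integral_prod_symm _ hA, ← integral_prod_symm _ hB, hAr, ← Measure.volume_eq_prod,
      integral_indicator hF1, hF1r, setIntegral_indicator hKm.compl,
      ← integral_inter_add_sdiff hKm hfi.integrableOn (s := F), add_comm]
    congr 2
    have : F \ K = E ×ˢ univ ∩ Kᶜ := by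
      ext x
      have := @h x
      simp only [Set.mem_symmDiff, Set.mem_sdiff, mem_inter_iff, mem_compl_iff] at *
      tauto
    rw [this]

lemma glue {S : ℕ → Set ℝ} {I : Set ℝ} (hI : volume I ≠ ⊤) (hS : ∀ j, IsOpen (S j))
    (hSI : ∀ j, S j ⊆ I)
    {f : ℕ → ℝ → ℝ} (hf : ∀ j, StronglyMeasurable (f j)) {C : ℕ → ℝ} (hfC : ∀ j t, |f j t| ≤ C j)
    {h : ℝ → ℝ} (hh : StronglyMeasurable h) (hhi : Integrable h) (hh0 : ∀ t ∉ I, h t = 0)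
    (hcov : ∀ t ∈ I, ∀ ε > (0:ℝ), ∃ j, t ∈ S j ∧ h t - ε < f j t) {ε : ℝ} (hε : 0 < ε) :
    ∃ (N : ℕ) (w : Fin N → ℝ → ℝ), (∀ j, ContDiff ℝ 1 (w j)) ∧ (∀ j, HasCompactSupport (w j)) ∧
      (∀ j, tsupport (w j) ⊆ S j) ∧ (∀ j t, w j t ∈ Icc (0:ℝ) 1) ∧
      (∀ i j t, i ≠ j → w i t = 0 ∨ w j t = 0) ∧
      (∫ t, h t) - ε ≤ ∑ j, ∫ t, w j t * f j t := by
  classical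
  obtain ⟨δ, hδ, hδI⟩ : ∃ δ > (0:ℝ), δ * (volume I).toReal ≤ ε / 3 := by
    refine ⟨ε / 3 / ((volume I).toReal + 1), by positivity, ?_⟩
    rw [div_mul_eq_mul_div, div_le_iff₀ (by positivity)]
    nlinarith [ENNReal.toReal_nonneg (a := volume I)]
  let Q : ℕ → Set ℝ := fun j => S j ∩ {t | h t - δ < f j t}
  have hQm : ∀ j, MeasurableSet (Q j) := fun j =>
    (hS j).measurableSet.inter (measurableSet_lt (hh.measurable.sub_const _) (hf j).measurable)
  let B := disjointed Q
  have hBm : ∀ j, MeasurableSet (B j) := fun j => MeasurableSet.disjointed hQm j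
  have hBd : Pairwise (Function.onFun Disjoint B) := disjoint_disjointed Q
  have hBQ : ∀ j, B j ⊆ Q j := fun j => disjointed_subset Q j
  have hBS : ∀ j, B j ⊆ S j := fun j => (hBQ j).trans inter_subset_left
  have hBU : ⋃ j, B j = I := by
    rw [show ⋃ j, B j = ⋃ j, Q j from iUnion_disjointed]
    apply subset_antisymm
    · exact iUnion_subset fun j => inter_subset_left.trans (hSI j)
    · intro t ht
      obtain ⟨j, h1, h2⟩ := hcov t ht δ hδ
      exact mem_iUnion.2 ⟨j, h1, h2⟩
  have hfin : ∀ s, s ⊆ I → volume s ≠ ⊤ := fun s hs => ne_top_of_le_ne_top hI (measure_mono hs)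
  have hsum := hasSum_integral_iUnion hBm hBd (hhi.integrableOn (s := ⋃ j, B j))
  rw [hBU, setIntegral_eq_integral_of_forall_compl_eq_zero hh0] at hsum
  obtain ⟨N, hN⟩ := ((tendsto_order.1 hsum.tendsto_sum_nat).1 _
    (show (∫ t, h t) - ε / 3 < ∫ t, h t by linarith)).exists
  have hfint : ∀ j s, s ⊆ I → IntegrableOn (f j) s := by
    intro j s hs
    have : IsFiniteMeasure ((volume : Measure ℝ).restrict s) := ⟨by
      rw [Measure.restrict_apply_univ]; exact (hfin s hs).lt_top⟩
    exact Integrable.of_bound (hf j).aestronglyMeasurable (C j)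
      (Eventually.of_forall fun t => by simpa using hfC j t)
  -- estimate on the B j
  have hest : ∑ j ∈ Finset.range N, ∫ t in B j, h t ≤
      ∑ j ∈ Finset.range N, (∫ t in B j, f j t) + ε / 3 := by
    have h1 : ∀ j, ∫ t in B j, h t ≤ (∫ t in B j, f j t) + δ * (volume (B j)).toReal := by
      intro j
      have hc : IntegrableOn (fun _ : ℝ => δ) (B j) :=
        integrableOn_const (hfin _ ((hBS j).trans (hSI j)))
      have : ∫ t in B j, h t ≤ ∫ t in B j, (f j t + δ) := by
        refine setIntegral_mono_on hhi.integrableOn ((hfint j _ ((hBS j).trans (hSI j))).add hc)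
          (hBm j) fun t ht => ?_
        have := (hBQ j ht).2
        simp only [mem_ofPred_eq] at this
        linarith
      rw [integral_add (hfint j _ ((hBS j).trans (hSI j))) hc] at this
      simpa [Measure.real, mul_comm] using this
    refine (Finset.sum_le_sum fun j _ => h1 j).trans ?_
    rw [Finset.sum_add_distrib, ← Finset.mul_sum]
    gcongr
    refine le_trans ?_ hδI
    gcongr
    rw [← ENNReal.toReal_sum fun j _ => hfin _ ((hBS j).trans (hSI j)),
      ← measure_biUnion_finset (fun i _ j _ hij => hBd hij) fun j _ => hBm j]
    exact ENNReal.toReal_mono hI (measure_mono (iUnion₂_subset fun j _ => (hBS j).trans (hSI j)))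
  -- compact approximations
  obtain ⟨M, hM0, hM⟩ : ∃ M > (0:ℝ), ∀ j < N, C j ≤ M := by
    refine ⟨∑ j ∈ Finset.range N, |C j| + 1, by positivity, fun j hj => ?_⟩
    have := Finset.single_le_sum (f := fun j => |C j|) (fun i _ => abs_nonneg _)
      (Finset.mem_range.2 hj)
    have h2 := le_abs_self (C j)
    linarith
  obtain ⟨ρ, hρ, hρε⟩ : ∃ ρ > (0:ℝ), N * (M * (2 * ρ)) ≤ ε / 3 := by
    refine ⟨ε / 3 / (2 * M * (N + 1)), by positivity, ?_⟩
    have : (N:ℝ) * (M * (2 * (ε / 3 / (2 * M * (N + 1))))) = (N / (N + 1)) * (ε / 3) := by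
      field_simp
    rw [this]
    apply mul_le_of_le_one_left (by positivity)
    rw [div_le_one (by positivity)]
    linarith
  have hρ' : ENNReal.ofReal ρ ≠ 0 := by simpa using hρ
  have hKex : ∀ j, ∃ K ⊆ B j, IsCompact K ∧ volume (B j \ K) < ENNReal.ofReal ρ := fun j =>
    (hBm j).exists_isCompact_sdiff_lt (hfin _ ((hBS j).trans (hSI j))) hρ'
  choose K hKB hKc hKρ using hKex
  have hUex : ∀ j, ∃ U ⊇ K j, IsOpen U ∧ volume U < volume (K j) + ENNReal.ofReal ρ := fun j =>
    (K j).exists_isOpen_lt_add (hKc j).measure_lt_top.ne hρ'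
  choose U hKU hUo hUρ using hUex
  have hdisj : Pairwise (Function.onFun Disjoint fun j : Fin N => 𝓝ˢ (K j)) := by
    intro i j hij
    apply disjoint_nhdsSet_nhdsSet (hKc i).isClosed (hKc j).isClosed
    exact (hBd (fun h => hij (Fin.ext h))).mono (hKB i) (hKB j)
  obtain ⟨s, hs1, hs2⟩ := hdisj.exists_mem_filter_of_disjoint
  have hw : ∀ j : Fin N, ∃ χ : ℝ → ℝ, ContDiff ℝ 1 χ ∧ HasCompactSupport χ ∧
      tsupport χ ⊆ U j ∩ S j ∩ interior (s j) ∧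
      (∀ x ∈ K j, ∀ᶠ y in 𝓝 x, χ y = 1) ∧ ∀ x, χ x ∈ Icc (0:ℝ) 1 := by
    intro j
    apply cutoff_exists (hKc j) (((hUo j).inter (hS j)).inter isOpen_interior)
    exact subset_inter (subset_inter (hKU j) ((hKB j).trans (hBS j)))
      (subset_interior_iff_mem_nhdsSet.2 (hs1 j))
  choose w hw1 hw2 hw3 hw4 hw5 using hw
  refine ⟨N, w, hw1, hw2, fun j => (hw3 j).trans (inter_subset_left.trans inter_subset_right),
    hw5, ?_, ?_⟩
  · intro i j t hij
    by_contra! hne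
    have h1 := interior_subset (hw3 i (subset_tsupport _ hne.1)).2
    have h2 := interior_subset (hw3 j (subset_tsupport _ hne.2)).2
    exact Set.disjoint_left.1 (hs2 hij) h1 h2
  · have happ : ∀ j : Fin N, (∫ t in B j, f j t) - M * (2 * ρ) ≤ ∫ t, w j t * f j t := by
      intro j
      have hBI := (hBS j).trans (hSI j)
      let R : Set ℝ := (B j \ K j) ∪ (U j \ K j)
      have hRm : MeasurableSet R := ((hBm j).diff (hKc j).measurableSet).union
        ((hUo j).measurableSet.diff (hKc j).measurableSet)
      have hUK : volume (U j \ K j) < ENNReal.ofReal ρ := by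
        rw [measure_sdiff (hKU j) (hKc j).measurableSet.nullMeasurableSet
          (hKc j).measure_lt_top.ne]
        exact ENNReal.sub_lt_of_lt_add (measure_mono (hKU j)) (by rw [add_comm]; exact hUρ j)
      have hRv : volume R ≤ ENNReal.ofReal (2 * ρ) := by
        refine (measure_union_le _ _).trans ?_
        rw [two_mul, ENNReal.ofReal_add hρ.le hρ.le]
        exact add_le_add (hKρ j).le hUK.le
      have hRfin : volume R ≠ ⊤ := ne_top_of_le_ne_top ENNReal.ofReal_ne_top hRv
      have hwint : Integrable fun t => w j t * f j t := by
        have hwi : Integrable (w j) :=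
          (hw1 j).continuous.integrable_of_hasCompactSupport (hw2 j)
        exact hwi.mul_bdd (c := C j) (hf j).aestronglyMeasurable
          (Eventually.of_forall fun t => by simpa using hfC j t)
      rw [← integral_indicator (hBm j)]
      have hB1 : Integrable ((B j).indicator (f j)) :=
        (integrable_indicator_iff (hBm j)).2 (hfint j _ hBI)
      have hR1 : Integrable (R.indicator fun _ => M) :=
        (integrable_indicator_iff hRm).2 (integrableOn_const hRfin)
      have hle : ∫ t, ((B j).indicator (f j) t - R.indicator (fun _ => M) t) ≤
          ∫ t, w j t * f j t := by
        refine integral_mono (hB1.sub hR1) hwint fun t => ?_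
        have hab := abs_le.1 ((hfC j t).trans (hM j j.2))
        have hwt := hw5 j t
        beta_reduce
        by_cases hK : t ∈ K j
        · have : w j t = 1 := (hw4 j t hK).self_of_nhds
          have hR : t ∉ R := fun h => h.elim (fun h => h.2 hK) fun h => h.2 hK
          simp [this, hR, hKB j hK]
        · by_cases hR : t ∈ R
          · rw [indicator_of_mem hR]
            by_cases hB : t ∈ B j
            · rw [indicator_of_mem hB]
              nlinarith [hwt.1, hwt.2]
            · rw [indicator_of_notMem hB]
              nlinarith [hwt.1, hwt.2]
          · have hB : t ∉ B j := fun h => hR (Or.inl ⟨h, hK⟩)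
            have hU : t ∉ U j := fun h => hR (Or.inr ⟨h, hK⟩)
            have : w j t = 0 := by
              by_contra hne
              exact hU (hw3 j (subset_tsupport _ hne)).1.1
            simp [this, hR, hB]
      rw [integral_sub hB1 hR1, integral_indicator hRm, setIntegral_const, smul_eq_mul] at hle
      have : volume.real R ≤ 2 * ρ := by
        rw [Measure.real]
        exact ENNReal.toReal_le_of_le_ofReal (by positivity) hRv
      nlinarith
    have h2 : ∑ j : Fin N, ((∫ t in B j, f j t) - M * (2 * ρ)) ≤ ∑ j, ∫ t, w j t * f j t :=
      Finset.sum_le_sum fun j _ => happ j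
    rw [Finset.sum_sub_distrib, Finset.sum_const, Finset.card_univ, Fintype.card_fin,
      nsmul_eq_mul, Fin.sum_univ_eq_sum_range (fun j => ∫ t in B j, f j t)] at h2
    linarith

/-- horizontal part of the divergence -/
noncomputable def horDiv {n : ℕ} (η : Rn1 n → Rn1 n) (z : Rn1 n) : ℝ :=
  ∑ i, (fderiv ℝ η z (EuclideanSpace.single i (1:ℝ), (0:ℝ))).1 i

lemma horDiv_continuous {n : ℕ} {η : Rn1 n → Rn1 n} (h : ContDiff ℝ 1 η) :
    Continuous (horDiv η) := by
  unfold horDiv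
  have := h.continuous_fderiv (by norm_num)
  fun_prop

lemma horDiv_hasCompactSupport {n : ℕ} {η : Rn1 n → Rn1 n} (h : HasCompactSupport η) :
    HasCompactSupport (horDiv η) := by
  have := h.fderiv (𝕜 := ℝ)
  apply this.mono
  intro x hx hx'
  apply hx
  simp [horDiv, hx']

lemma divN_slice {n : ℕ} {η : Rn1 n → Rn1 n} (h : ContDiff ℝ 1 η) (t : ℝ) (x : Rn n) :
    divN (fun y => (η (y, t)).1) x = horDiv η (x, t) := by
  unfold divN horDiv
  have h1 : HasFDerivAt η (fderiv ℝ η (x, t)) (x, t) :=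
    (h.differentiable (by norm_num) (x, t)).hasFDerivAt
  have h2 : HasFDerivAt (fun y : Rn n => (y, t)) (ContinuousLinearMap.inl ℝ (Rn n) ℝ) x :=
    hasFDerivAt_prodMk_left x t
  have h3 := (h1.comp x h2).fst
  rw [show (fun y => (η (y, t)).1) = fun y => ((η ∘ fun y : Rn n => (y, t)) y).1 from rfl,
    h3.fderiv]
  rfl

lemma slice_test {n : ℕ} {Φ : Rn1 n → ℝ} {φ : Rn n → ℝ}
    (hφ : ∀ z : Rn1 n, φ z.1 ≤ Φ z) {A : Set (Rn1 n)} {η : Rn1 n → Rn1 n}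
    (hη : Test1 A Φ η) (t : ℝ) :
    TestN {x | (x, t) ∈ A} φ (fun x => (η (x, t)).1) := by
  obtain ⟨h1, h2, h3, h4⟩ := hη
  have hsub : tsupport (fun x => (η (x, t)).1) ⊆ {x | (x, t) ∈ tsupport η} := by
    apply closure_minimal
    · intro x hx
      apply subset_tsupport
      intro h
      apply hx
      simp [h]
    · exact (isClosed_tsupport η).preimage (by fun_prop : Continuous fun x : Rn n => (x, t))
  refine ⟨contDiff_fst.comp (h1.comp (contDiff_id.prodMk contDiff_const)), ?_, ?_, ?_⟩
  · have : IsCompact (Prod.fst '' tsupport η) := IsCompact.image h2 continuous_fst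
    exact this.of_isClosed_subset isClosed_closure fun x hx => ⟨(x, t), hsub hx, rfl⟩
  · exact fun x hx => h3 (hsub hx)
  · exact fun x => (hφ _).trans (h4 _)

/-- slice functional of the cylinder -/
noncomputable def cylH {n : ℕ} (E : Set (Rn n)) (η : Rn1 n → Rn1 n) (t : ℝ) : ℝ :=
  -∫ x in E, divN (fun y => (η (y, t)).1) x

lemma prod_restr {n : ℕ} (E : Set (Rn n)) :
    ((volume : Measure (Rn n)).restrict E).prod (volume : Measure ℝ) =
      (volume : Measure (Rn1 n)).restrict (E ×ˢ univ) := by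
  rw [Measure.volume_eq_prod, ← Measure.prod_restrict, Measure.restrict_univ]

lemma cylH_meas {n : ℕ} (E : Set (Rn n)) {η : Rn1 n → Rn1 n} (h : ContDiff ℝ 1 η) :
    StronglyMeasurable (cylH E η) := by
  unfold cylH
  simp_rw [divN_slice h]
  exact ((horDiv_continuous h).stronglyMeasurable.integral_prod_left'
    (μ := volume.restrict E)).neg

lemma cylH_int {n : ℕ} (E : Set (Rn n)) {η : Rn1 n → Rn1 n} (h : ContDiff ℝ 1 η)
    (hc : HasCompactSupport η) : Integrable (cylH E η) := by
  unfold cylH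
  simp_rw [divN_slice h]
  have hi : Integrable (horDiv η)
      (((volume : Measure (Rn n)).restrict E).prod (volume : Measure ℝ)) := by
    rw [prod_restr]
    exact ((horDiv_continuous h).integrable_of_hasCompactSupport
      (horDiv_hasCompactSupport hc)).restrict
  exact hi.integral_prod_right.neg

lemma vert_zero {n : ℕ} {η : Rn1 n → Rn1 n} (h : ContDiff ℝ 1 η)
    (hc : HasCompactSupport η) (x : Rn n) :
    ∫ t, (fderiv ℝ η (x, t) ((0 : Rn n), (1:ℝ))).2 = 0 := by
  have hcd := h.continuous_fderiv (by norm_num)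
  have hcη := h.continuous
  have hcomp : IsCompact (Prod.snd '' tsupport η) := IsCompact.image hc continuous_snd
  apply integral_eq_zero_of_hasDerivAt_of_integrable (f := fun t => (η (x, t)).2)
  · intro t
    have h1 : HasFDerivAt η (fderiv ℝ η (x, t)) (x, t) :=
      (h.differentiable (by norm_num) (x, t)).hasFDerivAt
    have h2 : HasDerivAt (fun s : ℝ => (x, s)) ((0 : Rn n), (1:ℝ)) t :=
      (hasDerivAt_const t x).prodMk (hasDerivAt_id t)
    have h3 := h1.comp_hasDerivAt t h2
    exact (ContinuousLinearMap.snd ℝ (Rn n) ℝ).hasFDerivAt.comp_hasDerivAt t h3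
  · apply Continuous.integrable_of_hasCompactSupport (by fun_prop)
    apply HasCompactSupport.intro hcomp
    intro t ht
    have : fderiv ℝ η (x, t) = 0 := by
      by_contra hne
      exact ht ⟨(x, t), support_fderiv_subset ℝ hne, rfl⟩
    simp [this]
  · apply Continuous.integrable_of_hasCompactSupport (by fun_prop)
    apply HasCompactSupport.intro hcomp
    intro t ht
    have : η (x, t) = 0 := by
      by_contra hne
      exact ht ⟨(x, t), subset_tsupport _ hne, rfl⟩
    simp [this]

lemma cyl_integral {n : ℕ} (E : Set (Rn n)) {η : Rn1 n → Rn1 n} (h : ContDiff ℝ 1 η)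
    (hc : HasCompactSupport η) :
    -∫ z in E ×ˢ (univ : Set ℝ), div1 η z = ∫ t, cylH E η t := by
  have hcd := h.continuous_fderiv (by norm_num)
  let v : Rn1 n → ℝ := fun z => (fderiv ℝ η z ((0 : Rn n), (1:ℝ))).2
  have hv : Integrable v := by
    apply Continuous.integrable_of_hasCompactSupport (by fun_prop)
    apply (hc.fderiv (𝕜 := ℝ)).mono
    intro x hx hx'
    apply hx
    simp [v, hx']
  have hh : Integrable (horDiv η) := (horDiv_continuous h).integrable_of_hasCompactSupport
      (horDiv_hasCompactSupport hc)
  have : div1 η = fun z => horDiv η z + v z := rfl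
  rw [this, integral_add hh.integrableOn hv.integrableOn]
  have hv' : Integrable v
      (((volume : Measure (Rn n)).restrict E).prod (volume : Measure ℝ)) := by
    rw [prod_restr]; exact hv.restrict
  have hh' : Integrable (horDiv η)
      (((volume : Measure (Rn n)).restrict E).prod (volume : Measure ℝ)) := by
    rw [prod_restr]; exact hh.restrict
  have hv0 : ∫ z in E ×ˢ (univ : Set ℝ), v z = 0 := by
    rw [← prod_restr, integral_prod _ hv']
    simp [v, vert_zero h hc]
  rw [hv0, add_zero, ← prod_restr, integral_prod_symm _ hh', ← integral_neg]
  unfold cylH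
  simp_rw [divN_slice h]

lemma cylH_zero {n : ℕ} (E : Set (Rn n)) {η : Rn1 n → Rn1 n} {A : Set (Rn1 n)}
    (hs : tsupport η ⊆ A) (t : ℝ) (ht : t ∉ Prod.snd '' A) : cylH E η t = 0 := by
  have : (fun y => (η (y, t)).1) = fun _ => 0 := by
    ext1 y
    have : η (y, t) = 0 := by
      by_contra hne
      exact ht ⟨(y, t), hs (subset_tsupport _ hne), rfl⟩
    simp [this]
  simp [cylH, this, divN]

lemma cyl_BV {n : ℕ} {Ω E : Set (Rn n)} (hE : BVlocSetN Ω E) :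
    BVlocSet1 (Ω ×ˢ (univ : Set ℝ)) (E ×ˢ (univ : Set ℝ)) := by
  intro A hA
  obtain ⟨hAo, hAc, hAs⟩ := hA
  have hc1 : IsCompact (Prod.fst '' closure A) := hAc.image continuous_fst
  have hcl : closure (Prod.fst '' A) ⊆ Prod.fst '' closure A :=
    closure_minimal (image_mono subset_closure) hc1.isClosed
  have hA' : CpCtd (Prod.fst '' A) Ω := by
    refine ⟨isOpenMap_fst _ hAo, hc1.of_isClosed_subset isClosed_closure hcl, hcl.trans ?_⟩
    rintro _ ⟨z, hz, rfl⟩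
    exact (hAs hz).1
  obtain ⟨M, hM⟩ := hE _ hA'
  let J := Prod.snd '' closure A
  have hJ : IsCompact J := hAc.image continuous_snd
  refine ⟨∫ t, J.indicator (fun _ => |M|) t, ?_⟩
  rintro r ⟨η, hη, rfl⟩
  rw [cyl_integral E hη.1 hη.2.1]
  refine integral_mono (cylH_int E hη.1 hη.2.1)
    ((integrable_indicator_iff hJ.measurableSet).2 (integrableOn_const hJ.measure_lt_top.ne))
    fun t => ?_
  beta_reduce
  by_cases ht : t ∈ J
  · rw [indicator_of_mem ht]
    refine le_trans (hM ⟨_, ?_, rfl⟩) (le_abs_self M)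
    obtain ⟨a, b, c, d⟩ := slice_test (φ := fun x => ‖x‖) enorm1_fst_le hη t
    exact ⟨a, b, fun x hx => ⟨(x, t), c hx, rfl⟩, d⟩
  · rw [indicator_of_notMem ht, cylH_zero E (hη.2.2.1.trans subset_closure) t ht]

lemma prod_field_contDiff {n N : ℕ} {w : Fin N → ℝ → ℝ} {ζ : Fin N → Rn n → Rn n}
    (hw : ∀ j, ContDiff ℝ 1 (w j)) (hζ : ∀ j, ContDiff ℝ 1 (ζ j)) :
    ContDiff ℝ 1 (fun z : Rn1 n => ((∑ j, w j z.2 • ζ j z.1, (0:ℝ)) : Rn1 n)) := by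
  refine ContDiff.prodMk ?_ contDiff_const
  exact ContDiff.sum fun j _ =>
    ((hw j).comp contDiff_snd).smul ((hζ j).comp contDiff_fst)

lemma prod_field_div {n N : ℕ} {w : Fin N → ℝ → ℝ} {ζ : Fin N → Rn n → Rn n}
    (hw : ∀ j, ContDiff ℝ 1 (w j)) (hζ : ∀ j, ContDiff ℝ 1 (ζ j)) (x : Rn n) (t : ℝ) :
    div1 (fun z : Rn1 n => ((∑ j, w j z.2 • ζ j z.1, (0:ℝ)) : Rn1 n)) (x, t) =
      ∑ j, w j t * divN (ζ j) x := by
  have hcd := prod_field_contDiff hw hζ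
  have hd := hcd.differentiable (by norm_num) (x, t)
  have h2 : (fderiv ℝ (fun z : Rn1 n => ((∑ j, w j z.2 • ζ j z.1, (0:ℝ)) : Rn1 n)) (x, t)
      ((0 : Rn n), (1:ℝ))).2 = 0 := by
    have := hd.hasFDerivAt.snd.unique (hasFDerivAt_const (0:ℝ) (x, t))
    exact congrArg (fun L => L ((0 : Rn n), (1:ℝ))) this
  have h1 := divN_slice hcd t x
  unfold div1
  rw [h2, add_zero]
  change horDiv _ _ = _
  rw [← h1]
  unfold divN
  beta_reduce
  have h3 : HasFDerivAt (fun y : Rn n => ∑ j, w j t • ζ j y)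
      (∑ j, w j t • fderiv ℝ (ζ j) x) x := by
    apply HasFDerivAt.fun_sum
    intro j _
    exact ((hζ j).differentiable (by norm_num) x).hasFDerivAt.const_smul (w j t)
  rw [h3.fderiv]
  simp_rw [Finset.mul_sum]
  rw [Finset.sum_comm]
  refine Finset.sum_congr rfl fun i _ => ?_
  simp

lemma main_ineq {n : ℕ} (Φ : Rn1 n → ℝ) (hΦ : IsNorm1 Φ)
    (hgraph : ∀ ξ : Rn1 n, Φ (ξ.1, (0:ℝ)) ≤ Φ ξ)
    (Ω : Set (Rn n)) (E : Set (Rn n))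
    (hmin : MinPerN (fun ξh : Rn n => Φ (ξh, (0:ℝ))) Ω E)
    (A : Set (Rn1 n)) (hA : CpCtd A (Ω ×ˢ (univ : Set ℝ))) (F : Set (Rn1 n))
    (hF : BVlocSet1 (Ω ×ˢ (univ : Set ℝ)) F)
    (hK : IsCompact (closure (symmDiff (E ×ˢ (univ : Set ℝ)) F)))
    (hKA : closure (symmDiff (E ×ˢ (univ : Set ℝ)) F) ⊆ A)
    (η : Rn1 n → Rn1 n) (hη : Test1 A Φ η) {ε : ℝ} (hε : 0 < ε) :
    (-∫ z in E ×ˢ (univ : Set ℝ), div1 η z) - ε ≤ Per1 Φ F A := by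
  set K := closure (symmDiff (E ×ˢ (univ : Set ℝ)) F) with hKdef
  set φ : Rn n → ℝ := fun ξh : Rn n => Φ (ξh, (0:ℝ)) with hφdef
  have hΦ0 : Φ 0 = 0 := by
    have := hΦ.2.1 0 0
    simpa using this
  have hφ0 : φ 0 = 0 := hΦ0
  obtain ⟨G, hG1, hG2, hG3⟩ := slices_exist E F K isClosed_closure subset_closure
  obtain ⟨ζ, hζ1, hζ2⟩ := countable_tests φ (by rw [hφ0]; exact zero_le_one)
  have hζi : ∀ j, Integrable (divN (ζ j)) := fun j => divN_integrable (hζ1 j).1 (hζ1 j).2.1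
  let I := Prod.snd '' A
  have hIo : IsOpen I := isOpenMap_snd _ hA.1
  have hIf : volume I ≠ ⊤ := by
    have : IsCompact (Prod.snd '' closure A) := hA.2.1.image continuous_snd
    exact ne_top_of_le_ne_top this.measure_lt_top.ne (measure_mono (image_mono subset_closure))
  let S : ℕ → Set ℝ := fun j => {t | ∀ x ∈ tsupport (ζ j), (x, t) ∈ A} ∩ I
  have hSo : ∀ j, IsOpen (S j) := by
    intro j
    refine IsOpen.inter ?_ hIo
    rw [isOpen_iff_mem_nhds]
    intro t ht
    have hc : IsCompact (tsupport (ζ j)) := (hζ1 j).2.1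
    obtain ⟨u, v, -, hv, hu, htv, huv⟩ := generalized_tube_lemma hc (isCompact_singleton (x := t))
      hA.1 (by rintro ⟨x, s⟩ ⟨hx, hs⟩; have hs2 : s = t := hs; subst hs2; exact ht x hx)
    exact mem_of_superset (hv.mem_nhds (htv rfl)) fun s hs x hx => huv ⟨hu hx, hs⟩
  have hcov : ∀ t ∈ I, ∀ ε > (0:ℝ), ∃ j, t ∈ S j ∧
      cylH E η t - ε < -∫ x in G t, divN (ζ j) x := by
    intro t ht ε hε
    have hct : Continuous fun x : Rn n => (x, t) := by fun_prop
    have hslc : ∀ L : Set (Rn1 n), IsCompact L → IsCompact {x : Rn n | (x, t) ∈ L} := by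
      intro L hL
      exact (hL.image continuous_fst).of_isClosed_subset (hL.isClosed.preimage hct)
        fun x hx => ⟨(x, t), hx, rfl⟩
    have hPo : IsOpen {x : Rn n | (x, t) ∈ A} := hA.1.preimage hct
    have hPcl : closure {x : Rn n | (x, t) ∈ A} ⊆ {x : Rn n | (x, t) ∈ closure A} :=
      closure_minimal (fun x hx => subset_closure hx) (isClosed_closure.preimage hct)
    have hP : CpCtd {x : Rn n | (x, t) ∈ A} Ω :=
      ⟨hPo, (hslc _ hA.2.1).of_isClosed_subset isClosed_closure hPcl,
        fun x hx => (hA.2.2 (hPcl hx)).1⟩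
    obtain ⟨θ, hθ, hlt⟩ := slice_key hΦ hmin hP (hslc K hK) (fun x hx => hKA hx) (hG1 t)
      (slice_test (φ := φ) hgraph hη t) (half_pos hε)
    obtain ⟨j, hj1, hj2⟩ := hζ2 _ hPo θ hθ _ (half_pos hε)
    refine ⟨j, ⟨fun x hx => hj1 hx, ht⟩, ?_⟩
    have hθi : Integrable (divN θ) := divN_integrable hθ.1 hθ.2.1
    have hd : |∫ x in G t, (divN (ζ j) x - divN θ x)| ≤ ∫ x, |divN (ζ j) x - divN θ x| := by
      refine abs_integral_le_integral_abs.trans ?_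
      exact setIntegral_le_integral ((hζi j).sub hθi).abs
        (Eventually.of_forall fun x => abs_nonneg _)
    rw [integral_sub (hζi j).integrableOn hθi.integrableOn] at hd
    have := (abs_le.1 hd).2
    have h1 : cylH E η t - ε / 2 < -∫ x in G t, divN θ x := hlt
    linarith
  have hfm : ∀ j, StronglyMeasurable fun t => -∫ x in G t, divN (ζ j) x := fun j =>
    (hG2 (fun z => divN (ζ j) z.1) ((divN_continuous (hζ1 j).1).comp continuous_fst)
      fun _ => hζi j).neg
  have hfC : ∀ j t, |-∫ x in G t, divN (ζ j) x| ≤ ∫ x, |divN (ζ j) x| := by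
    intro j t
    rw [abs_neg]
    refine abs_integral_le_integral_abs.trans ?_
    exact setIntegral_le_integral (hζi j).abs (Eventually.of_forall fun x => abs_nonneg _)
  obtain ⟨N, w, hw1, hw2, hw3, hw4, hw5, hw6⟩ := glue hIf hSo (fun j => inter_subset_right) hfm hfC
    (cylH_meas E hη.1) (cylH_int E hη.1 hη.2.1) (fun t ht => cylH_zero E hη.2.2.1 t ht) hcov hε
  rw [cyl_integral E hη.1 hη.2.1]
  refine hw6.trans ?_
  let η' : Rn1 n → Rn1 n := fun z => (∑ j : Fin N, w j z.2 • ζ j z.1, (0:ℝ))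
  have hη'c : ContDiff ℝ 1 η' := prod_field_contDiff hw1 fun j => (hζ1 j).1
  let L : Set (Rn1 n) := ⋃ j : Fin N, tsupport (ζ j) ×ˢ tsupport (w j)
  have hL : IsCompact L := isCompact_iUnion fun j => IsCompact.prod (hζ1 j).2.1 (hw2 j)
  have hLA : L ⊆ A := by
    refine iUnion_subset fun j => ?_
    rintro ⟨x, t⟩ ⟨hx, ht⟩
    exact (hw3 j ht).1 x hx
  have hη'0 : ∀ z ∉ L, η' z = 0 := by
    intro z hz
    have : ∑ j : Fin N, w j z.2 • ζ j z.1 = 0 := by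
      refine Finset.sum_eq_zero fun j _ => ?_
      by_contra hne
      rw [smul_eq_zero, not_or] at hne
      exact hz (mem_iUnion.2 ⟨j, subset_tsupport _ hne.2, subset_tsupport _ hne.1⟩)
    simp only [η', this]
    rfl
  have hη's : tsupport η' ⊆ L := by
    refine closure_minimal (fun z hz => ?_) hL.isClosed
    by_contra h
    exact hz (hη'0 z h)
  have hη'cs : HasCompactSupport η' := hL.of_isClosed_subset isClosed_closure hη's
  have htest : Test1 A Φ η' := by
    refine ⟨hη'c, hη'cs, hη's.trans hLA, fun z => ?_⟩
    by_cases hz : ∃ j, w j z.2 ≠ 0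
    · obtain ⟨j, hj⟩ := hz
      have hsum : ∑ j : Fin N, w j z.2 • ζ j z.1 = w j z.2 • ζ j z.1 := by
        refine Finset.sum_eq_single j (fun i _ hij => ?_) (by simp)
        rcases hw5 i j z.2 hij with h | h
        · simp [h]
        · exact absurd h hj
      have : η' z = w j z.2 • ((ζ j z.1, (0:ℝ)) : Rn1 n) := by
        simp only [η', hsum, Prod.smul_mk, smul_zero]
      rw [this, hΦ.2.1, abs_of_nonneg (hw4 j z.2).1]
      have h1 : Φ (ζ j z.1, (0:ℝ)) ≤ 1 := (hζ1 j).2.2.2 z.1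
      nlinarith [(hw4 j z.2).1, (hw4 j z.2).2]
    · push Not at hz
      have : η' z = 0 := by
        simp only [η', hz, zero_smul, Finset.sum_const_zero]
        rfl
      rw [this, hΦ0]
      exact zero_le_one
  have hval : ∑ j : Fin N, ∫ t, w j t * -∫ x in G t, divN (ζ j) x = -∫ z in F, div1 η' z := by
    rw [hG3 (div1 η') (div1_continuous hη'c) (div1_hasCompactSupport hη'cs), ← integral_neg,
      ← integral_finsetSum]
    · congr 1
      ext1 t
      have : ∀ x, div1 η' (x, t) = ∑ j : Fin N, w j t * divN (ζ j) x := fun x =>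
        prod_field_div (ζ := fun j : Fin N => ζ j) hw1 (fun j => (hζ1 j).1) x t
      simp_rw [this]
      have hI : ∀ j : Fin N, j ∈ Finset.univ → Integrable (fun x => w j t * divN (ζ j) x)
          (volume.restrict (G t)) := fun j _ => ((hζi j).const_mul (w j t)).integrableOn
      rw [integral_finsetSum _ hI]
      simp_rw [integral_const_mul, mul_neg]
      rw [Finset.sum_neg_distrib]
    · intro j _
      have hwi : Integrable (w j) :=
        (hw1 j).continuous.integrable_of_hasCompactSupport (hw2 j)
      exact hwi.mul_bdd (c := ∫ x, |divN (ζ j) x|) (hfm j).aestronglyMeasurable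
        (Eventually.of_forall fun t => by simpa using hfC j t)
  rw [hval]
  exact le_csSup (bdd1 hΦ (hF A hA)) ⟨η', htest, rfl⟩

theorem cylinder_over_minimizer {n : ℕ} (Φ : Rn1 n → ℝ) (hΦ : IsNorm1 Φ)
    (hgraph : ∀ ξ : Rn1 n, Φ (ξ.1, (0:ℝ)) ≤ Φ ξ)
    (Ω : Set (Rn n)) (hΩ : IsOpen Ω) (E : Set (Rn n))
    (hmin : MinPerN (fun ξh : Rn n => Φ (ξh, (0:ℝ))) Ω E) :
    MinPer1 Φ (Ω ×ˢ (univ : Set ℝ)) (E ×ˢ (univ : Set ℝ)) := by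
  refine ⟨cyl_BV hmin.1, fun A hA F hF hK hKA => ?_⟩
  refine csSup_le ?_ ?_
  · have hΦ0 : Φ 0 = 0 := by
      have := hΦ.2.1 0 0
      simpa using this
    refine ⟨_, fun _ => 0, ⟨contDiff_const, HasCompactSupport.zero,
        by simp [tsupport, Function.support_fun_zero], fun _ => ?_⟩, rfl⟩
    rw [hΦ0]
    exact zero_le_one
  · rintro r ⟨η, hη, rfl⟩
    refine le_of_forall_sub_le fun ε hε => ?_
    exact main_ineq Φ hΦ hgraph Ω E hmin A hA F hF hK hKA η hη hε
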